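/- Let G = (V,E,ℓ) be a weighted k-path separable graph with n vertices whose weighted diameter is at most D. Then there exist a set Z ⊆ V with |Z| ≥ (3/4)·n and a collection B = {P₁, …, P_κ} of κ ≤ k simple paths in G, each of total length at most 32D, such that for every vertex v ∈ Z not lying on any of these paths, the closed ball of radius 8D around v in the graph obtained from G by deleting all vertices of the paths in B contains at most (3/4)·n vertices. -/

import Mathlib

open SimpleGraph

section Defs

variable {V : Type} [Fintype V] [DecidableEq V]

/-- Total length of a walk with respect to edge lengths `ℓ`. -/
def wlen {G : SimpleGraph V} (ℓ : Sym2 V → ℝ) {u v : V} (p : G.Walk u v) : ℝ :=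
  (p.edges.map ℓ).sum

/-- All vertices of the walk lie in the vertex set `A`. -/
def WalkIn {G : SimpleGraph V} (A : Set V) {u v : V} (p : G.Walk u v) : Prop :=
  ∀ x ∈ p.support, x ∈ A

/-- The distance between `u` and `v` within the induced subgraph on `A`
is at most `r`: there is a walk of total length at most `r` that stays in `A`. -/
def DistLE (G : SimpleGraph V) (ℓ : Sym2 V → ℝ) (A : Set V) (u v : V) (r : ℝ) : Prop :=
  ∃ p : G.Walk u v, WalkIn A p ∧ wlen ℓ p ≤ r

/-- Edge lengths are positive on all edges. -/
def PosWeights (G : SimpleGraph V) (ℓ : Sym2 V → ℝ) : Prop :=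
  ∀ e ∈ G.edgeSet, 0 < ℓ e

/-- A (simple) path in `G`, bundled with its endpoints. -/
structure PathIn (G : SimpleGraph V) where
  src : V
  dst : V
  walk : G.Walk src dst
  isPath : walk.IsPath

/-- The set of vertices lying on some path of the list `L`. -/
def pathSupp {G : SimpleGraph V} (L : List (PathIn G)) : Set V :=
  {x | ∃ p ∈ L, x ∈ p.walk.support}

/-- The set of vertices lying on some path of some group in `L`. -/
def suppL {G : SimpleGraph V} (L : List (List (PathIn G))) : Set V :=
  {x | ∃ ps ∈ L, ∃ p ∈ ps, x ∈ p.walk.support}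

/-- `p` is a shortest path of the subgraph induced on `A`. -/
def IsShortestPathIn (G : SimpleGraph V) (ℓ : Sym2 V → ℝ) (A : Set V) (p : PathIn G) : Prop :=
  WalkIn A p.walk ∧ ∀ q : G.Walk p.src p.dst, WalkIn A q → wlen ℓ p.walk ≤ wlen ℓ q

/-- The induced subgraph of `G` on the vertex set `A` is `k`-path separable:
there is a sequence of groups of paths, each path being a shortest path of the
graph obtained by deleting the vertices of all previous groups, with at most `k`
paths in total, such that after deleting all these paths every connected component
has at most half as many vertices, and the remaining graph is empty or itself
`k`-path separable. -/
inductive KPathSep (G : SimpleGraph V) (ℓ : Sym2 V → ℝ) (k : ℕ) : Set V → Prop where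
  | step : ∀ (A : Set V) (L : List (List (PathIn G))),
      (L.map List.length).sum ≤ k →
      (∀ i : Fin L.length, ∀ p ∈ L.get i,
        IsShortestPathIn G ℓ (A \ suppL (L.take i)) p) →
      (∀ v ∈ A \ suppL L,
        2 * Set.ncard {w | w ∈ A \ suppL L ∧ ∃ q : G.Walk v w, WalkIn (A \ suppL L) q}
          ≤ Set.ncard A) →
      (A \ suppL L ≠ ∅ → KPathSep G ℓ k (A \ suppL L)) →
      KPathSep G ℓ k A

/-- `G` is universally `k`-path separable: it is `k`-path separable
for every positive edge-length function. -/
def UnivKPathSeparable (G : SimpleGraph V) (k : ℕ) : Prop :=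
  ∀ ℓ : Sym2 V → ℝ, PosWeights G ℓ → KPathSep G ℓ k Set.univ

end Defs

section CoreSet

variable {V : Type} {G : SimpleGraph V} {ℓ : Sym2 V → ℝ}

lemma wlen_append {u v w : V} (p : G.Walk u v) (q : G.Walk v w) :
    wlen ℓ (p.append q) = wlen ℓ p + wlen ℓ q := by
  simp [wlen, SimpleGraph.Walk.edges_append]

lemma wlen_reverse {u v : V} (p : G.Walk u v) : wlen ℓ p.reverse = wlen ℓ p := by
  simp [wlen, SimpleGraph.Walk.edges_reverse, List.sum_reverse]

lemma wlen_nonneg (hpos : PosWeights G ℓ) {u v : V} (p : G.Walk u v) : 0 ≤ wlen ℓ p := by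
  apply List.sum_nonneg
  intro x hx
  obtain ⟨e, he, rfl⟩ := List.mem_map.1 hx
  exact (hpos e (p.edges_subset_edgeSet he)).le

lemma WalkIn.append {A : Set V} {u v w : V} {p : G.Walk u v} {q : G.Walk v w}
    (hp : WalkIn A p) (hq : WalkIn A q) : WalkIn A (p.append q) := by
  intro x hx
  rcases (SimpleGraph.Walk.mem_support_append_iff p q).1 hx with h | h
  · exact hp x h
  · exact hq x h

lemma WalkIn.reverse {A : Set V} {u v : V} {p : G.Walk u v} (hp : WalkIn A p) :
    WalkIn A p.reverse := by
  intro x hx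
  exact hp x (by simpa using hx)

/-- Every vertex of a walk of length at most `r` is within distance `r` of its start. -/
lemma DistLE.of_mem_support [DecidableEq V] (hpos : PosWeights G ℓ) {A : Set V} {u v x : V} {r : ℝ}
    (p : G.Walk u v) (hp : WalkIn A p) (hr : wlen ℓ p ≤ r) (hx : x ∈ p.support) :
    DistLE G ℓ A u x r := by
  refine ⟨p.takeUntil x hx, fun y hy => hp y (p.support_takeUntil_subset_support hx hy), ?_⟩
  have h := congrArg (wlen ℓ) (p.take_spec hx)
  rw [wlen_append] at h
  linarith [wlen_nonneg hpos (p.dropUntil x hx)]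

lemma DistLE.mono {A A' : Set V} (hA : A ⊆ A') {u v : V} {r : ℝ} (h : DistLE G ℓ A u v r) :
    DistLE G ℓ A' u v r := by
  obtain ⟨p, hp, hr⟩ := h
  exact ⟨p, fun x hx => hA (hp x hx), hr⟩

/-- A walk meeting `S` has a suffix starting in `S` and containing all its vertices in `S`. -/
lemma exists_suffix_from {S : Set V} {u v : V} (p : G.Walk u v)
    (h : ∃ x ∈ p.support, x ∈ S) :
    ∃ a ∈ S, ∃ (p₁ : G.Walk u a) (q : G.Walk a v), p = p₁.append q ∧
      ∀ x ∈ p.support, x ∈ S → x ∈ q.support := by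
  induction p with
  | nil =>
    obtain ⟨x, hx, hxS⟩ := h
    simp only [SimpleGraph.Walk.support_nil, List.mem_singleton] at hx
    subst hx
    exact ⟨x, hxS, .nil, .nil, rfl, fun _ hy _ => hy⟩
  | @cons u w v hadj p ih =>
    by_cases hu : u ∈ S
    · exact ⟨u, hu, .nil, .cons hadj p, rfl, fun _ hy _ => hy⟩
    · have key : ∀ x ∈ (SimpleGraph.Walk.cons hadj p).support, x ∈ S → x ∈ p.support := by
        intro x hx hxS
        rw [SimpleGraph.Walk.support_cons, List.mem_cons] at hx
        rcases hx with rfl | hx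
        · exact absurd hxS hu
        · exact hx
      obtain ⟨x, hx, hxS⟩ := h
      obtain ⟨a, ha, p₁, q, rfl, hq⟩ := ih ⟨x, key x hx hxS, hxS⟩
      exact ⟨a, ha, .cons hadj p₁, q, rfl, fun y hy hyS => hq y (key y hy hyS) hyS⟩

/-- A walk meeting `S` has a subwalk with endpoints in `S` containing all its vertices in `S`. -/
lemma exists_segment_between {S : Set V} {u v : V} (p : G.Walk u v)
    (h : ∃ x ∈ p.support, x ∈ S) :
    ∃ a ∈ S, ∃ b ∈ S, ∃ (p₁ : G.Walk u a) (q : G.Walk a b) (p₂ : G.Walk b v),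
      p = p₁.append (q.append p₂) ∧ ∀ x ∈ p.support, x ∈ S → x ∈ q.support := by
  obtain ⟨a, ha, p₁, q, rfl, hq⟩ := exists_suffix_from p h
  obtain ⟨b, hb, r, s, hrs, hs⟩ := exists_suffix_from (S := S) q.reverse
    ⟨a, by simp, ha⟩
  refine ⟨a, ha, b, hb, p₁, s.reverse, r.reverse, ?_, ?_⟩
  · rw [← SimpleGraph.Walk.reverse_append, ← hrs, SimpleGraph.Walk.reverse_reverse]
  · intro x hx hxS
    have := hs x (by simpa using hq x hx hxS) hxS
    simpa using this

/-- A segment of a shortest path is no longer than any walk between its endpoints. -/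
lemma IsShortestPathIn.wlen_segment_le {A : Set V} {P : PathIn G}
    (hP : IsShortestPathIn G ℓ A P) {a b : V} {p₁ : G.Walk P.src a} {q : G.Walk a b}
    {p₂ : G.Walk b P.dst} (h : P.walk = p₁.append (q.append p₂)) {r : G.Walk a b}
    (hr : WalkIn A r) : wlen ℓ q ≤ wlen ℓ r := by
  have h₁ : WalkIn A p₁ := fun x hx => hP.1 x (by
    rw [h, SimpleGraph.Walk.mem_support_append_iff]; exact .inl hx)
  have h₂ : WalkIn A p₂ := fun x hx => hP.1 x (by
    rw [h, SimpleGraph.Walk.mem_support_append_iff, SimpleGraph.Walk.mem_support_append_iff]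
    exact .inr (.inr hx))
  have := hP.2 _ (h₁.append (hr.append h₂))
  rw [h] at this
  simp only [wlen_append] at this
  linarith

/-- The ball of radius `r` around `v` in the graph without the vertices of the paths in `B`. -/
def ballAvoiding (ℓ : Sym2 V → ℝ) (r : ℝ) (B : List (PathIn G)) (v : V) : Set V :=
  {u | DistLE G ℓ (Set.univ \ pathSupp B) v u r}

/-- The ball around `v` contains more than three quarters of the vertices. -/
def HasLargeBall [Fintype V] (ℓ : Sym2 V → ℝ) (r : ℝ) (B : List (PathIn G)) (v : V) : Prop :=
  3 / 4 * (Fintype.card V : ℝ) < ((ballAvoiding ℓ r B v).ncard : ℝ)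

/-- Every large ball avoids the vertex set `T`. -/
def LargeBallsAvoid [Fintype V] (ℓ : Sym2 V → ℝ) (r : ℝ) (B : List (PathIn G)) (T : Set V) :
    Prop :=
  ∀ v, HasLargeBall ℓ r B v → ∀ u ∈ ballAvoiding ℓ r B v, u ∉ T

lemma ballAvoiding_cons_subset (r : ℝ) (P : PathIn G) (B : List (PathIn G)) (v : V) :
    ballAvoiding ℓ r (P :: B) v ⊆ ballAvoiding ℓ r B v := by
  intro u hu
  refine DistLE.mono ?_ hu
  rintro x ⟨-, hx⟩
  refine ⟨trivial, fun ⟨p, hp, hxp⟩ => hx ⟨p, List.mem_cons_of_mem _ hp, hxp⟩⟩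

lemma notMem_pathSupp_of_mem_ballAvoiding {r : ℝ} {B : List (PathIn G)} {u v : V}
    (hu : u ∈ ballAvoiding ℓ r B v) : u ∉ pathSupp B := by
  obtain ⟨p, hp, -⟩ := hu
  exact (hp u p.end_mem_support).2

lemma HasLargeBall.of_cons [Fintype V] {r : ℝ} {P : PathIn G} {B : List (PathIn G)} {v : V}
    (h : HasLargeBall ℓ r (P :: B) v) : HasLargeBall ℓ r B v := by
  refine lt_of_lt_of_le h ?_
  exact_mod_cast Set.ncard_le_ncard (ballAvoiding_cons_subset r P B v) (Set.toFinite _)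

lemma HasLargeBall.inter_nonempty [Fintype V] {r : ℝ} {B : List (PathIn G)} {v w : V}
    (hv : HasLargeBall ℓ r B v) (hw : HasLargeBall ℓ r B w) :
    (ballAvoiding ℓ r B v ∩ ballAvoiding ℓ r B w).Nonempty := by
  by_contra hne
  rw [Set.not_nonempty_iff_eq_empty, ← Set.disjoint_iff_inter_eq_empty] at hne
  have h₁ := Set.ncard_union_eq hne (Set.toFinite _) (Set.toFinite _)
  have h₂ : (ballAvoiding ℓ r B v ∪ ballAvoiding ℓ r B w).ncard ≤ Fintype.card V := by
    rw [← Nat.card_eq_fintype_card, ← Set.ncard_univ]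
    exact Set.ncard_le_ncard (Set.subset_univ _) (Set.toFinite _)
  rw [h₁] at h₂
  have h₃ : ((ballAvoiding ℓ r B v).ncard : ℝ) + (ballAvoiding ℓ r B w).ncard
      ≤ Fintype.card V := by exact_mod_cast h₂
  unfold HasLargeBall at hv hw
  have : (0 : ℝ) ≤ Fintype.card V := Nat.cast_nonneg _
  linarith

/-- A walk from the centre of a large ball to one of its points that avoids `T`. -/
lemma LargeBallsAvoid.exists_walk [Fintype V] [DecidableEq V]
    (hpos : PosWeights G ℓ) {r : ℝ} {B : List (PathIn G)}
    {T A : Set V} (hB : LargeBallsAvoid ℓ r B T) (hA : Tᶜ ⊆ A) {u v : V}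
    (hv : HasLargeBall ℓ r B v) (hu : u ∈ ballAvoiding ℓ r B v) :
    ∃ p : G.Walk v u, WalkIn A p ∧ wlen ℓ p ≤ r := by
  obtain ⟨p, hp, hr⟩ := hu
  exact ⟨p, fun x hx => hA (hB v hv x (DistLE.of_mem_support hpos p hp hr hx)), hr⟩

/-- Cutting out a segment of length at most `4 * r` of a shortest path makes all large balls
avoid this path. -/
lemma LargeBallsAvoid.exists_add_path [Fintype V] [DecidableEq V]
    (hpos : PosWeights G ℓ) {r : ℝ} {B : List (PathIn G)}
    {T A : Set V} (hB : LargeBallsAvoid ℓ r B T) (hA : Tᶜ ⊆ A)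
    (hlen : ∀ p ∈ B, wlen ℓ p.walk ≤ 4 * r) {P : PathIn G} (hP : IsShortestPathIn G ℓ A P) :
    ∃ B' : List (PathIn G), B'.length ≤ B.length + 1 ∧ (∀ p ∈ B', wlen ℓ p.walk ≤ 4 * r) ∧
      LargeBallsAvoid ℓ r B' (T ∪ {x | x ∈ P.walk.support}) := by
  let S : Set V := {u | ∃ v, HasLargeBall ℓ r B v ∧ u ∈ ballAvoiding ℓ r B v}
  by_cases h : ∃ x ∈ P.walk.support, x ∈ S
  · obtain ⟨a, ⟨v, hv, hav⟩, b, ⟨w, hw, hbw⟩, p₁, q, p₂, hdec, hq⟩ :=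
      exists_segment_between P.walk h
    have hqp : q.IsPath := by
      have := P.isPath
      rw [hdec] at this
      exact this.of_append_right.of_append_left
    refine ⟨⟨a, b, q, hqp⟩ :: B, by simp, ?_, ?_⟩
    · intro p hp
      rcases List.mem_cons.1 hp with rfl | hp
      · obtain ⟨c, hcv, hcw⟩ := hv.inter_nonempty hw
        obtain ⟨s₁, hs₁, hl₁⟩ := hB.exists_walk hpos hA hv hav
        obtain ⟨s₂, hs₂, hl₂⟩ := hB.exists_walk hpos hA hv hcv
        obtain ⟨s₃, hs₃, hl₃⟩ := hB.exists_walk hpos hA hw hcw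
        obtain ⟨s₄, hs₄, hl₄⟩ := hB.exists_walk hpos hA hw hbw
        have := hP.wlen_segment_le hdec
          ((hs₁.reverse.append hs₂).append (hs₃.reverse.append hs₄))
        simp only [wlen_append, wlen_reverse] at this
        change wlen ℓ q ≤ 4 * r
        linarith
      · exact hlen p hp
    · rintro x hx u hu (huT | huP)
      · exact hB x hx.of_cons u (ballAvoiding_cons_subset r _ B x hu) huT
      · refine notMem_pathSupp_of_mem_ballAvoiding hu ⟨_, List.mem_cons_self, ?_⟩
        exact hq u huP ⟨x, hx.of_cons, ballAvoiding_cons_subset r _ B x hu⟩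
  · refine ⟨B, by simp, hlen, ?_⟩
    rintro x hx u hu (huT | huP)
    · exact hB x hx u hu huT
    · exact h ⟨u, huP, x, hx, hu⟩

lemma LargeBallsAvoid.exists_add_group [Fintype V] [DecidableEq V]
    (hpos : PosWeights G ℓ) {r : ℝ} {A : Set V}
    (ps : List (PathIn G)) (hps : ∀ p ∈ ps, IsShortestPathIn G ℓ A p) {B : List (PathIn G)}
    {T : Set V} (hB : LargeBallsAvoid ℓ r B T) (hA : Tᶜ ⊆ A)
    (hlen : ∀ p ∈ B, wlen ℓ p.walk ≤ 4 * r) :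
    ∃ B' : List (PathIn G), B'.length ≤ B.length + ps.length ∧
      (∀ p ∈ B', wlen ℓ p.walk ≤ 4 * r) ∧ LargeBallsAvoid ℓ r B' (T ∪ pathSupp ps) := by
  induction ps generalizing B T with
  | nil =>
    refine ⟨B, by simp, hlen, ?_⟩
    have : pathSupp ([] : List (PathIn G)) = ∅ := by ext; simp [pathSupp]
    rwa [this, Set.union_empty]
  | cons P ps ih =>
    obtain ⟨B₁, hc₁, hl₁, hB₁⟩ :=
      hB.exists_add_path hpos hA hlen (hps P List.mem_cons_self)
    obtain ⟨B₂, hc₂, hl₂, hB₂⟩ := ih (fun p hp => hps p (List.mem_cons_of_mem _ hp)) hB₁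
      ((Set.compl_subset_compl.2 Set.subset_union_left).trans hA) hl₁
    refine ⟨B₂, by simp only [List.length_cons]; omega, hl₂, ?_⟩
    have : T ∪ pathSupp (P :: ps) = T ∪ {x | x ∈ P.walk.support} ∪ pathSupp ps := by
      ext; simp [pathSupp, or_assoc]
    rwa [this]

lemma suppL_append_singleton (L : List (List (PathIn G))) (ps : List (PathIn G)) :
    suppL (L ++ [ps]) = suppL L ∪ pathSupp ps := by
  ext x
  simp [suppL, pathSupp, or_and_right, exists_or]

lemma exists_largeBallsAvoid_suppL_take [Fintype V] [DecidableEq V] (hpos : PosWeights G ℓ) (r : ℝ)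
    (L : List (List (PathIn G)))
    (hL : ∀ i : Fin L.length, ∀ p ∈ L.get i,
      IsShortestPathIn G ℓ (Set.univ \ suppL (L.take i)) p) (i : ℕ) (hi : i ≤ L.length) :
    ∃ B : List (PathIn G), B.length ≤ ((L.take i).map List.length).sum ∧
      (∀ p ∈ B, wlen ℓ p.walk ≤ 4 * r) ∧ LargeBallsAvoid ℓ r B (suppL (L.take i)) := by
  induction i with
  | zero => exact ⟨[], by simp, by simp, by intro _ _ _ _; simp [suppL]⟩
  | succ i ih =>
    obtain ⟨B, hc, hl, hB⟩ := ih (by omega)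
    obtain ⟨B', hc', hl', hB'⟩ := hB.exists_add_group hpos (L.get ⟨i, hi⟩) (hL ⟨i, hi⟩)
      (fun x hx => ⟨trivial, hx⟩) hl
    have htake : L.take (i + 1) = L.take i ++ [L.get ⟨i, hi⟩] := by simp
    rw [htake]
    refine ⟨B', ?_, hl', by rwa [suppL_append_singleton]⟩
    rw [List.map_append, List.sum_append, List.map_singleton, List.sum_singleton]
    omega

end CoreSet

/-- **Core set and boundary for k-path separable graphs.** Let `G = (V,E,ℓ)` be
a weighted `k`-path separable graph with `n` vertices whose weighted diameter
is at most `D`. Then there exist a set `Z ⊆ V` with `|Z| ≥ (3/4)·n` and a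
collection of at most `k` simple paths in `G`, each of total length at most
`32D`, such that for every `v ∈ Z` not lying on any of these paths, the closed
ball of radius `8D` around `v` in the graph obtained by deleting all vertices
of these paths contains at most `(3/4)·n` vertices. -/
theorem core_set_and_boundary_exist {V : Type} [Fintype V] [DecidableEq V]
    (G : SimpleGraph V) (ℓ : Sym2 V → ℝ) (k : ℕ) (D : ℝ)
    (hpos : PosWeights G ℓ)
    (hsep : KPathSep G ℓ k Set.univ)
    (hdiam : ∀ u v : V, DistLE G ℓ Set.univ u v D) :
    ∃ (Z : Set V) (B : List (PathIn G)),
      3 / 4 * (Fintype.card V : ℝ) ≤ (Z.ncard : ℝ) ∧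
      B.length ≤ k ∧
      (∀ p ∈ B, wlen ℓ p.walk ≤ 32 * D) ∧
      (∀ v ∈ Z, v ∉ pathSupp B →
        (Set.ncard {u : V | DistLE G ℓ (Set.univ \ pathSupp B) v u (8 * D)} : ℝ) ≤
          3 / 4 * (Fintype.card V : ℝ)) := by
  obtain ⟨_, L, hk, hL, hcomp, -⟩ := hsep
  obtain ⟨B, hc, hl, hB⟩ :=
    exists_largeBallsAvoid_suppL_take hpos (8 * D) L hL L.length le_rfl
  rw [List.take_length] at hc hB
  have hcard : (Set.univ : Set V).ncard = Fintype.card V := by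
    rw [Set.ncard_univ, Nat.card_eq_fintype_card]
  have hn : (0 : ℝ) ≤ Fintype.card V := Nat.cast_nonneg _
  refine ⟨Set.univ, B, ?_, hc.trans hk, fun p hp => by linarith [hl p hp], ?_⟩
  · rw [hcard]
    linarith
  · intro v _ _
    by_contra hlarge
    replace hlarge : HasLargeBall ℓ (8 * D) B v := lt_of_not_ge hlarge
    have hwalk : ∀ u ∈ ballAvoiding ℓ (8 * D) B v,
        ∃ q : G.Walk v u, WalkIn (Set.univ \ suppL L) q := by
      intro u hu
      obtain ⟨q, hq, -⟩ := hB.exists_walk hpos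
        (show (suppL L)ᶜ ⊆ Set.univ \ suppL L from fun x hx => ⟨trivial, hx⟩) hlarge hu
      exact ⟨q, hq⟩
    obtain ⟨c, hcv, -⟩ := hlarge.inter_nonempty hlarge
    obtain ⟨q, hq⟩ := hwalk c hcv
    have hle := hcomp v (hq v q.start_mem_support)
    have hsub := Set.ncard_le_ncard (s := ballAvoiding ℓ (8 * D) B v)
      (t := {w | w ∈ Set.univ \ suppL L ∧
        ∃ q : G.Walk v w, WalkIn (Set.univ \ suppL L) q})
      (fun u hu => by
        obtain ⟨q, hq⟩ := hwalk u hu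
        exact ⟨hq u q.end_mem_support, q, hq⟩) (Set.toFinite _)
    rw [hcard] at hle
    have hhalf : 2 * ((ballAvoiding ℓ (8 * D) B v).ncard : ℝ) ≤ Fintype.card V := by
      exact_mod_cast (Nat.mul_le_mul_left 2 hsub).trans hle
    unfold HasLargeBall at hlarge
    linarith
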